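/- arXiv:1504.00041 — 4 statements merged into one kernel-verified Lean document; each statement's English description precedes it below -/
import Mathlib

section
/- Let S ⊆ K, let d : S → ℝ, and let y_{u_j} ≥ 0, y_{v_j} ≥ 0 (j ∈ S) satisfy y_{u_i} + y_{v_j} ≥ α_{ij} for all i, j ∈ S with i ≠ j, and y_{u_j} + y_{v_j} = α_{jj} − d_j for all j ∈ S. Set r_j = −y_{u_j} for j ∈ S. Then r_j ≤ 0 for all j ∈ S, and treating interference as noise with these power exponents achieves at least the target GDoF of every user: α_{jj} + r_j − max{0, max_{i∈S, i≠j}(α_{ij} + r_i)} ≥ d_j for every j ∈ S. -/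
/-- If nonnegative labels `y_u, y_v` on `S` satisfy the dual assignment
constraints `y_{u_i} + y_{v_j} ≥ α_{ij}` for `i ≠ j` and `y_{u_j} + y_{v_j} = α_{jj} − d_j`,
then the power exponents `r_j = −y_{u_j}` are nonpositive and treating interference as
noise with these exponents achieves at least the target GDoF `d_j` for every `j ∈ S`. -/
theorem tin_labels_achieve {ι : Type*} [Fintype ι] [DecidableEq ι]
    (α : ι → ι → ℝ) (hα : ∀ i j, 0 ≤ α i j)
    (S : Finset ι) (d : ι → ℝ) (yu yv : ι → ℝ)
    (hyu0 : ∀ j ∈ S, 0 ≤ yu j) (hyv0 : ∀ j ∈ S, 0 ≤ yv j)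
    (hcross : ∀ i ∈ S, ∀ j ∈ S, i ≠ j → α i j ≤ yu i + yv j)
    (hdiag : ∀ j ∈ S, yu j + yv j = α j j - d j)
    (r : ι → ℝ) (hr : ∀ j ∈ S, r j = -yu j) :
    (∀ j ∈ S, r j ≤ 0) ∧
    (∀ j ∈ S, d j ≤ α j j + r j - (S.erase j).fold max 0 (fun i => α i j + r i)) := by
  refine ⟨fun j hj => by linarith [hr j hj, hyu0 j hj], fun j hj => ?_⟩
  have hfold : (S.erase j).fold max 0 (fun i => α i j + r i) ≤ yv j := by
    refine Finset.fold_max_le (yv j) |>.mpr ⟨hyv0 j hj, fun i hi => ?_⟩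
    obtain ⟨hij, hiS⟩ := Finset.mem_erase.mp hi
    linarith [hcross i hiS j hj hij, hr i hiS]
  linarith [hdiag j hj, hr j hj]
end

section
/- Let S ⊆ K and let d ∈ ℝ^K satisfy d_k ≥ 0 for all k ∈ S and d_i = 0 for all i ∉ S. Define the weight matrix A on S × S by A_{ij} = α_{ij} for i ≠ j and A_{jj} = α_{jj} − d_j. Then d ∈ P^TINA_S if and only if the diagonal matching {(j,j) : j ∈ S} is a maximum-weight matching of the complete bipartite graph on S × S with weights A; that is, Σ_{j∈S} A_{jj} ≥ Σ_{(i,j)∈M} A_{ij} for every matching M ⊆ S × S. -/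
noncomputable def alphaP {ι : Type*} [DecidableEq ι] (α : ι → ι → ℝ) (i j : ι) : ℝ :=
  if i = j then 0 else α i j

/-- A matching of the complete bipartite graph on `S × S`: a set of pairs in which no two
pairs share the same first coordinate and no two pairs share the same second coordinate. -/
def IsMatching {ι : Type*} (S : Finset ι) (M : Finset (ι × ι)) : Prop :=
  M ⊆ S ×ˢ S ∧
  (∀ p ∈ M, ∀ q ∈ M, p.1 = q.1 → p = q) ∧
  (∀ p ∈ M, ∀ q ∈ M, p.2 = q.2 → p = q)

/-- The maximum weight `w(M*_S)` of a matching of the complete bipartite graph on `S × S`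
with weights `α'` (the empty matching is allowed, so `w(M*_S) = 0` when `|S| ≤ 1`
whenever `α'` has zero diagonal and is nonnegative). -/
noncomputable def wStar {ι : Type*} [DecidableEq ι] (α' : ι → ι → ℝ) (S : Finset ι) : ℝ :=
  letI := Classical.propDecidable
  ((S ×ˢ S).powerset.filter (fun M => IsMatching S M)).sup'
    ⟨∅, by simp [IsMatching, Finset.mem_filter]⟩ (fun M => ∑ p ∈ M, α' p.1 p.2)

/-- The matching-form polyhedral TIN-achievable region `P^TINA_S`. -/
noncomputable def TINA {ι : Type*} [DecidableEq ι] (α : ι → ι → ℝ) (S : Finset ι)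
    (d : ι → ℝ) : Prop :=
  (∀ i ∉ S, d i = 0) ∧ (∀ k ∈ S, 0 ≤ d k) ∧
  ∀ S' ⊆ S, S'.Nonempty → ∑ k ∈ S', d k ≤ ∑ k ∈ S', α k k - wStar (alphaP α) S'

/-- Condition (C1): for every `k`, `α_{kk} ≥ α_{ik} + α_{kj} − α'_{ij}` for all `i ≠ k`,
`j ≠ k`. -/
def CondC1 {ι : Type*} [DecidableEq ι] (α : ι → ι → ℝ) : Prop :=
  ∀ k i j : ι, i ≠ k → j ≠ k → α i k + α k j - alphaP α i j ≤ α k k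

/-- Condition (C2): every subset of size `> 2` admits a maximum-weight matching containing
a zero-strength pair. -/
def CondC2 {ι : Type*} [DecidableEq ι] (α : ι → ι → ℝ) : Prop :=
  ∀ S' : Finset ι, 2 < S'.card →
    ∃ M : Finset (ι × ι), IsMatching S' M ∧
      (∑ p ∈ M, alphaP α p.1 p.2) = wStar (alphaP α) S' ∧
      ∃ p ∈ M, α p.1 p.2 = 0

theorem wStar_le_iff {ι : Type*} [DecidableEq ι] (β : ι → ι → ℝ) (S : Finset ι) (c : ℝ) :
    wStar β S ≤ c ↔ ∀ M : Finset (ι × ι), IsMatching S M → ∑ p ∈ M, β p.1 p.2 ≤ c := by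
  classical
  refine (Finset.sup'_le_iff _ _).trans ⟨fun h M hM => h M ?_, fun h M hM => h M ?_⟩
  · exact Finset.mem_filter.2 ⟨Finset.mem_powerset.2 hM.1, hM⟩
  · exact (Finset.mem_filter.1 hM).2

theorem sum_alphaP_eq_sum_offDiag {ι : Type*} [DecidableEq ι] (α : ι → ι → ℝ)
    (M : Finset (ι × ι)) :
    ∑ p ∈ M, alphaP α p.1 p.2 = ∑ p ∈ M with p.1 ≠ p.2, α p.1 p.2 := by
  simp [Finset.sum_filter, alphaP]

theorem IsMatching.union_diag {ι : Type*} [DecidableEq ι] {S T : Finset ι}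
    {M : Finset (ι × ι)} (hT : T ⊆ S) (hM : IsMatching T M) :
    IsMatching S (M ∪ (S \ T).diag) := by
  obtain ⟨hsub, h₁, h₂⟩ := hM
  have hmem : ∀ p ∈ M, p.1 ∈ T ∧ p.2 ∈ T := fun p hp => Finset.mem_product.1 (hsub hp)
  refine ⟨fun p hp => ?_, fun p hp q hq h => ?_, fun p hp q hq h => ?_⟩ <;>
    simp only [Finset.mem_union, Finset.mem_diag, Finset.mem_sdiff, Finset.mem_product] at * <;>
    grind

theorem IsMatching.subset {ι : Type*} {S : Finset ι} {M N : Finset (ι × ι)}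
    (hM : IsMatching S M) (hN : N ⊆ M) : IsMatching S N :=
  ⟨hN.trans hM.1, fun p hp q hq => hM.2.1 p (hN hp) q (hN hq),
    fun p hp q hq => hM.2.2 p (hN hp) q (hN hq)⟩

/-- The off-diagonal pairs of a matching avoid the indices matched to themselves. -/
theorem IsMatching.offDiag {ι : Type*} [DecidableEq ι] {S : Finset ι} {M : Finset (ι × ι)}
    (hM : IsMatching S M) :
    IsMatching {j ∈ S | (j, j) ∉ M} {p ∈ M | p.1 ≠ p.2} := by
  obtain ⟨hsub, h₁, h₂⟩ := hM
  refine ⟨fun p hp => ?_, fun p hp q hq => ?_, fun p hp q hq => ?_⟩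
  · obtain ⟨hpM, hne⟩ := Finset.mem_filter.1 hp
    obtain ⟨hp₁, hp₂⟩ := Finset.mem_product.1 (hsub hpM)
    simp only [Finset.mem_product, Finset.mem_filter]
    refine ⟨⟨hp₁, fun h => hne ?_⟩, hp₂, fun h => hne ?_⟩
    · exact (congrArg Prod.snd (h₁ p hpM _ h rfl)).symm
    · exact congrArg Prod.fst (h₂ p hpM _ h rfl)
  · exact h₁ p (Finset.mem_filter.1 hp).1 q (Finset.mem_filter.1 hq).1
  · exact h₂ p (Finset.mem_filter.1 hp).1 q (Finset.mem_filter.1 hq).1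

theorem IsMatching.sum_diag {ι : Type*} [DecidableEq ι] {S : Finset ι} {M : Finset (ι × ι)}
    (hM : IsMatching S M) (A : ι → ι → ℝ) :
    ∑ p ∈ M with p.1 = p.2, A p.1 p.2 = ∑ j ∈ S with (j, j) ∈ M, A j j := by
  have h : ({p ∈ M | p.1 = p.2} : Finset (ι × ι)) = ({j ∈ S | (j, j) ∈ M} : Finset ι).diag := by
    ext ⟨i, j⟩
    have := @hM.1 (i, j)
    simp only [Finset.mem_filter, Finset.mem_diag, Finset.mem_product] at *
    grind
  rw [h, Finset.sum_diag]

/-- With weights `A_{ij} = α_{ij}` for `i ≠ j` and `A_{jj} = α_{jj} − d_j`,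
a vector `d` (vanishing outside `S`, nonnegative on `S`) lies in `P^TINA_S` if and only if
the diagonal matching `{(j,j) : j ∈ S}` is a maximum-weight matching of the complete
bipartite graph on `S × S` with weights `A`. -/
theorem tina_iff_diagonal_max_matching {ι : Type*} [Fintype ι] [DecidableEq ι]
    (α : ι → ι → ℝ) (hα : ∀ i j, 0 ≤ α i j)
    (S : Finset ι) (d : ι → ℝ)
    (hd0 : ∀ k ∈ S, 0 ≤ d k) (hd1 : ∀ i ∉ S, d i = 0)
    (A : ι → ι → ℝ)
    (hA : ∀ i j : ι, A i j = if i = j then α j j - d j else α i j) :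
    TINA α S d ↔
      ∀ M : Finset (ι × ι), IsMatching S M →
        ∑ p ∈ M, A p.1 p.2 ≤ ∑ j ∈ S, A j j := by
  have hle : ∀ T : Finset ι, (∑ k ∈ T, d k ≤ ∑ k ∈ T, α k k - wStar (alphaP α) T) ↔
      ∀ M : Finset (ι × ι), IsMatching T M →
        ∑ p ∈ M with p.1 ≠ p.2, A p.1 p.2 ≤ ∑ j ∈ T, A j j := by
    intro T
    have hdiag : ∑ j ∈ T, A j j = ∑ k ∈ T, α k k - ∑ k ∈ T, d k := by
      simp [hA, Finset.sum_sub_distrib]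
    have hoff : ∀ M : Finset (ι × ι), ∑ p ∈ M with p.1 ≠ p.2, A p.1 p.2 =
        ∑ p ∈ M, alphaP α p.1 p.2 := by
      intro M
      rw [sum_alphaP_eq_sum_offDiag]
      refine Finset.sum_congr rfl fun p hp => ?_
      rw [hA, if_neg (Finset.mem_filter.1 hp).2]
    simp only [hoff, hdiag]
    rw [← wStar_le_iff, le_sub_comm]
  constructor
  · rintro ⟨-, -, h⟩ M hM
    have hoff : ∑ p ∈ M with p.1 ≠ p.2, A p.1 p.2 ≤ ∑ j ∈ S with (j, j) ∉ M, A j j := by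
      have hN := hM.offDiag
      obtain hT | hT := ({j ∈ S | (j, j) ∉ M} : Finset ι).eq_empty_or_nonempty
      · have hempty := hN.1
        rw [hT, Finset.product_empty, Finset.subset_empty] at hempty
        rw [hT, hempty]
        simp
      · simpa [Finset.filter_filter] using
          (hle _).1 (h _ (Finset.filter_subset _ _) hT) _ hN
    rw [← Finset.sum_filter_add_sum_filter_not M (fun p => p.1 = p.2),
      ← Finset.sum_filter_add_sum_filter_not S (fun j => (j, j) ∈ M), hM.sum_diag]
    gcongr
  · refine fun h => ⟨hd1, hd0, fun T hT _ => (hle T).2 fun M hM => ?_⟩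
    have hN : IsMatching T {p ∈ M | p.1 ≠ p.2} := hM.subset (Finset.filter_subset _ _)
    have hdisj : Disjoint ({p ∈ M | p.1 ≠ p.2} : Finset (ι × ι)) (S \ T).diag := by
      rw [Finset.disjoint_left]
      exact fun p hp hq => (Finset.mem_filter.1 hp).2 (Finset.mem_diag.1 hq).2
    have hsum := h _ (hN.union_diag hT)
    rw [Finset.sum_union hdisj, Finset.sum_diag, ← Finset.sum_sdiff hT] at hsum
    linarith
end

section
/- For every S ⊆ K, the cyclic-form polyhedral TIN region equals the matching-form region: a vector d ∈ ℝ^K with d_i = 0 for all i ∉ S and 0 ≤ d_k ≤ α_{kk} for all k ∈ S satisfies, for every m ∈ {2,…,|S|} and every tuple (i_0,…,i_{m−1}) of m distinct elements of S, the cyclic inequality Σ_{k=0}^{m−1} d_{i_k} ≤ Σ_{k=0}^{m−1} (α_{i_k i_k} − α_{i_{(k−1) mod m} i_k}), if and only if for every nonempty S' ⊆ S it satisfies Σ_{k∈S'} d_k ≤ Σ_{k∈S'} α_{kk} − w(M*_{S'}). In particular, the TIN-achievable polytope P^TINA_S can be described by the 2^{|S|} − 1 matching-based inequalities, one for each nonempty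 subset S' of S. -/
theorem le_wStar {ι : Type*} [DecidableEq ι] (w : ι → ι → ℝ) {S : Finset ι}
    {M : Finset (ι × ι)} (hM : IsMatching S M) : ∑ p ∈ M, w p.1 p.2 ≤ wStar w S := by
  classical
  unfold wStar
  refine Finset.le_sup' (fun M : Finset (ι × ι) => ∑ p ∈ M, w p.1 p.2) ?_
  simp only [Finset.mem_filter, Finset.mem_powerset]
  exact ⟨hM.1, hM⟩

theorem exists_isMatching_eq_wStar {ι : Type*} [DecidableEq ι] (w : ι → ι → ℝ) (S : Finset ι) :
    ∃ M, IsMatching S M ∧ wStar w S = ∑ p ∈ M, w p.1 p.2 := by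
  classical
  unfold wStar
  obtain ⟨M, hM, h⟩ := Finset.exists_mem_eq_sup' _ (fun M : Finset (ι × ι) => ∑ p ∈ M, w p.1 p.2)
  exact ⟨M, (Finset.mem_filter.1 hM).2, h⟩

theorem alphaP_nonneg {ι : Type*} [DecidableEq ι] {α : ι → ι → ℝ} (hα : ∀ i j, 0 ≤ α i j)
    (i j : ι) : 0 ≤ alphaP α i j := by
  unfold alphaP
  split_ifs
  exacts [le_rfl, hα i j]

theorem isMatching_image_cycle {ι : Type*} [DecidableEq ι] {m : ℕ} [NeZero m] {f : Fin m → ι}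
    (hf : Function.Injective f) :
    IsMatching (Finset.univ.image f) (Finset.univ.image fun k => (f (k - 1), f k)) := by
  refine ⟨?_, ?_, ?_⟩
  · intro p hp
    obtain ⟨k, -, rfl⟩ := Finset.mem_image.1 hp
    simp
  · intro p hp q hq h
    obtain ⟨k, -, rfl⟩ := Finset.mem_image.1 hp
    obtain ⟨l, -, rfl⟩ := Finset.mem_image.1 hq
    have : k = l := sub_left_injective (hf h)
    rw [this]
  · intro p hp q hq h
    obtain ⟨k, -, rfl⟩ := Finset.mem_image.1 hp
    obtain ⟨l, -, rfl⟩ := Finset.mem_image.1 hq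
    rw [hf h]

/-- A matching on `S × S` extends to a permutation supported on `S`. -/
theorem IsMatching.exists_perm {ι : Type*} [Fintype ι] [DecidableEq ι] {S : Finset ι}
    {M : Finset (ι × ι)} (hM : IsMatching S M) :
    ∃ σ : Equiv.Perm ι, σ.support ⊆ S ∧ ∀ p ∈ M, σ p.1 = p.2 := by
  classical
  obtain ⟨hS, h1, h2⟩ := hM
  have hex : ∀ i : ι, ∃ j, (∃ j', (i, j') ∈ M) → (i, j) ∈ M := fun i => by
    by_cases h : ∃ j', (i, j') ∈ M
    · exact ⟨h.choose, fun _ => h.choose_spec⟩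
    · exact ⟨i, fun h' => absurd h' h⟩
  choose f hf using hex
  obtain ⟨g, hg⟩ := Finset.exists_equiv_extend_of_card_eq (α := S) (t := S) (by simp)
    (s := Finset.univ.filter fun i : S => ∃ j, (i.1, j) ∈ M) (f := fun i => f i.1)
    (by
      intro j hj
      obtain ⟨i, hi, rfl⟩ := Finset.mem_image.1 hj
      exact (Finset.mem_product.1 (hS (hf i (Finset.mem_filter.1 hi).2))).2)
    (by
      intro i hi j hj hij
      have hi' := hf i (Finset.mem_filter.1 hi).2
      have hj' := hf j (Finset.mem_filter.1 hj).2
      exact Subtype.ext (congrArg Prod.fst (h2 _ hi' _ hj' hij)))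
  refine ⟨Equiv.Perm.ofSubtype (p := (· ∈ S)) g, ?_, ?_⟩
  · intro i hi
    by_contra h
    exact Equiv.Perm.mem_support.1 hi (Equiv.Perm.ofSubtype_apply_of_not_mem _ h)
  · intro p hp
    have hpS : p.1 ∈ S := (Finset.mem_product.1 (hS hp)).1
    rw [Equiv.Perm.ofSubtype_apply_of_mem _ hpS, hg ⟨p.1, hpS⟩ (by simpa using ⟨p.2, hp⟩)]
    exact congrArg Prod.snd (h1 _ (hf p.1 ⟨p.2, hp⟩) _ hp rfl)

/-- The support of a cycle is enumerated by an injective tuple on which the cycle acts as the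
cyclic shift. -/
theorem Equiv.Perm.IsCycle.exists_enum {ι : Type*} [Fintype ι] [DecidableEq ι]
    {σ : Equiv.Perm ι} (hσ : σ.IsCycle) :
    ∃ (n : ℕ) (f : Fin (n + 2) → ι), Function.Injective f ∧
      Finset.univ.image f = σ.support ∧ ∀ k, σ (f k) = f (k + 1) := by
  obtain ⟨n, hn⟩ : ∃ n, σ.support.card = n + 2 :=
    ⟨_, (Nat.sub_add_cancel hσ.two_le_card_support).symm⟩
  obtain ⟨a, ha⟩ := hσ.nonempty_support
  have ho : orderOf σ = n + 2 := hσ.orderOf.trans hn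
  have hinj : Function.Injective fun k : Fin (n + 2) => (σ ^ (k : ℕ)) a := by
    intro k l hkl
    have hpow : σ ^ (k : ℕ) = σ ^ (l : ℕ) :=
      hσ.pow_eq_pow_iff.2 ⟨a, Equiv.Perm.mem_support.1 ha, hkl⟩
    exact Fin.ext (pow_injOn_Iio_orderOf (by simp [ho]) (by simp [ho]) hpow)
  refine ⟨n, _, hinj, ?_, fun k => ?_⟩
  · apply Finset.eq_of_subset_of_card_le
    · intro i hi
      obtain ⟨k, -, rfl⟩ := Finset.mem_image.1 hi
      exact Equiv.Perm.pow_apply_mem_support.2 ha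
    · rw [Finset.card_image_of_injective _ hinj, hn, Finset.card_fin]
  · have hv : ((k + 1 : Fin (n + 2)) : ℕ) = ((k : ℕ) + 1) % orderOf σ := by
      rw [ho, Fin.val_add, Fin.val_one]
    simp only [hv, pow_mod_orderOf, pow_succ', Equiv.Perm.mul_apply]

/-- If `∑ c k (σ k) ≤ 0` over the support of every cycle `σ` supported on `S`, then the same holds
for every permutation supported on `S`. -/
theorem Equiv.Perm.sum_support_nonpos_of_isCycle {ι : Type*} [Fintype ι] [DecidableEq ι]
    (c : ι → ι → ℝ) (S : Finset ι)
    (h : ∀ σ : Equiv.Perm ι, σ.IsCycle → σ.support ⊆ S → ∑ k ∈ σ.support, c k (σ k) ≤ 0)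
    (σ : Equiv.Perm ι) (hσ : σ.support ⊆ S) : ∑ k ∈ σ.support, c k (σ k) ≤ 0 := by
  induction σ using Equiv.Perm.cycle_induction_on with
  | base_one => simp
  | base_cycles σ hc => exact h σ hc hσ
  | induction_disjoint σ τ hd hc ih₁ ih₂ =>
    rw [hd.support_mul] at hσ ⊢
    rw [Finset.sum_union hd.disjoint_support]
    have e₁ : ∑ k ∈ σ.support, c k ((σ * τ) k) = ∑ k ∈ σ.support, c k (σ k) := by
      refine Finset.sum_congr rfl fun k hk => ?_
      have : τ k = k := (hd k).resolve_left (Equiv.Perm.mem_support.1 hk)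
      rw [Equiv.Perm.mul_apply, this]
    have e₂ : ∑ k ∈ τ.support, c k ((σ * τ) k) = ∑ k ∈ τ.support, c k (τ k) := by
      refine Finset.sum_congr rfl fun k hk => ?_
      have : σ k = k := (hd k).resolve_right (Equiv.Perm.mem_support.1 hk)
      rw [hd.commute.eq, Equiv.Perm.mul_apply, this]
    rw [e₁, e₂]
    exact add_nonpos (ih₁ (Finset.union_subset_left hσ)) (ih₂ (Finset.union_subset_right hσ))

/-- The cyclic-form polyhedral TIN region equals the matching-form region:
`d` (vanishing outside `S`, with `0 ≤ d_k ≤ α_{kk}` on `S`) satisfies all cyclic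
inequalities over tuples of `m` distinct elements of `S` (for every `2 ≤ m ≤ |S|`,
here `m = n + 2`, index arithmetic modulo `m`) iff it satisfies the `2^{|S|} − 1`
matching-based inequalities, one for each nonempty `S' ⊆ S`. -/
theorem cyclic_iff_matching_region {ι : Type*} [Fintype ι] [DecidableEq ι]
    (α : ι → ι → ℝ) (hα : ∀ i j, 0 ≤ α i j)
    (S : Finset ι) (d : ι → ℝ)
    (hd0 : ∀ i ∉ S, d i = 0) (hd1 : ∀ k ∈ S, 0 ≤ d k ∧ d k ≤ α k k) :
    (∀ n : ℕ, n + 2 ≤ S.card → ∀ f : Fin (n + 2) → ι,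
        Function.Injective f → (∀ k, f k ∈ S) →
        ∑ k : Fin (n + 2), d (f k) ≤
          ∑ k : Fin (n + 2), (α (f k) (f k) - α (f (k - 1)) (f k))) ↔
    (∀ S' ⊆ S, S'.Nonempty →
        ∑ k ∈ S', d k ≤ ∑ k ∈ S', α k k - wStar (alphaP α) S') := by
  constructor
  · intro h S' hS' _
    obtain ⟨M, hM, hw⟩ := exists_isMatching_eq_wStar (alphaP α) S'
    obtain ⟨σ, hσ, hσM⟩ := hM.exists_perm
    have hcyc : ∀ τ : Equiv.Perm ι, τ.IsCycle → τ.support ⊆ S →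
        ∑ k ∈ τ.support, (d k - α k k + α k (τ k)) ≤ 0 := by
      intro τ hτ hτS
      obtain ⟨n, f, hf, him, hshift⟩ := hτ.exists_enum
      have hfS : ∀ k, f k ∈ S := fun k =>
        hτS (him ▸ Finset.mem_image_of_mem f (Finset.mem_univ k))
      have hcard : n + 2 ≤ S.card := by
        have := Finset.card_le_card hτS
        rwa [← him, Finset.card_image_of_injective _ hf, Finset.card_fin] at this
      have hcyc := h n hcard f hf hfS
      have hrot : ∑ k, α (f (k - 1)) (f k) = ∑ k, α (f k) (f (k + 1)) := by
        rw [← Equiv.sum_comp (Equiv.addRight (1 : Fin (n + 2)))]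
        simp
      rw [Finset.sum_sub_distrib, hrot] at hcyc
      rw [← him, Finset.sum_image hf.injOn]
      simp only [hshift, Finset.sum_add_distrib, Finset.sum_sub_distrib]
      linarith
    have hsupp := Equiv.Perm.sum_support_nonpos_of_isCycle
      (fun i j => d i - α i i + α i j) S hcyc σ (hσ.trans hS')
    have hsum : ∑ k ∈ S', (d k - α k k + alphaP α k (σ k)) ≤ 0 := by
      rw [← Finset.sum_sdiff hσ]
      refine add_nonpos (Finset.sum_nonpos fun k hk => ?_) (le_of_eq_of_le ?_ hsupp)
      · obtain ⟨hk, hk'⟩ := Finset.mem_sdiff.1 hk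
        rw [Equiv.Perm.notMem_support.1 hk', alphaP, if_pos rfl]
        linarith [(hd1 k (hS' hk)).2]
      · refine Finset.sum_congr rfl fun k hk => ?_
        rw [alphaP, if_neg (Equiv.Perm.mem_support.1 hk).symm]
    have hle : ∑ p ∈ M, alphaP α p.1 p.2 ≤ ∑ k ∈ S', alphaP α k (σ k) := by
      calc ∑ p ∈ M, alphaP α p.1 p.2 = ∑ p ∈ M, alphaP α p.1 (σ p.1) :=
            Finset.sum_congr rfl fun p hp => by rw [hσM p hp]
        _ = ∑ k ∈ M.image Prod.fst, alphaP α k (σ k) :=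
            (Finset.sum_image (f := fun k => alphaP α k (σ k))
              fun p hp q hq => hM.2.1 p hp q hq).symm
        _ ≤ ∑ k ∈ S', alphaP α k (σ k) := by
            refine Finset.sum_le_sum_of_subset_of_nonneg ?_ fun k _ _ => alphaP_nonneg hα _ _
            intro k hk
            obtain ⟨p, hp, rfl⟩ := Finset.mem_image.1 hk
            exact (Finset.mem_product.1 (hM.1 hp)).1
    rw [Finset.sum_add_distrib, Finset.sum_sub_distrib] at hsum
    linarith
  · intro h n _ f hf hfS
    have hsub : Finset.univ.image f ⊆ S := Finset.image_subset_iff.2 fun k _ => hfS k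
    have hreg := h _ hsub (Finset.univ_nonempty.image f)
    have hw := le_wStar (alphaP α) (isMatching_image_cycle hf)
    have hpair : Function.Injective fun k => (f (k - 1), f k) :=
      fun k l hkl => hf (congrArg Prod.snd hkl)
    rw [Finset.sum_image hpair.injOn] at hw
    have hα' : ∀ k, alphaP α (f (k - 1)) (f k) = α (f (k - 1)) (f k) := fun k =>
      if_neg fun hk => one_ne_zero (sub_eq_self.1 (hf hk))
    simp only [hα'] at hw
    rw [Finset.sum_image hf.injOn, Finset.sum_image hf.injOn] at hreg
    rw [Finset.sum_sub_distrib]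
    linarith
end

section
/- Assume condition (C1). Then for every S ⊆ K and every k ∈ S, the increase of the maximum matching weight caused by including user k is at most the desired signal strength of user k: w(M*_S) − w(M*_{S∖{k}}) ≤ α_{kk}. -/
theorem IsMatching.sum_le_wStar {ι : Type*} [DecidableEq ι] {S : Finset ι}
    {M : Finset (ι × ι)} (hM : IsMatching S M) (w : ι → ι → ℝ) :
    ∑ p ∈ M, w p.1 p.2 ≤ wStar w S := by
  classical
  unfold wStar
  exact Finset.le_sup' (fun M : Finset (ι × ι) => ∑ p ∈ M, w p.1 p.2)
    (Finset.mem_filter.2 ⟨Finset.mem_powerset.2 hM.1, hM⟩)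

theorem wStar_le {ι : Type*} [DecidableEq ι] {S : Finset ι} {w : ι → ι → ℝ} {c : ℝ}
    (h : ∀ M, IsMatching S M → ∑ p ∈ M, w p.1 p.2 ≤ c) : wStar w S ≤ c := by
  classical
  unfold wStar
  exact Finset.sup'_le _ _ fun M hM => h M (Finset.mem_filter.1 hM).2

/-- A submatching that avoids `k` in both coordinates is a matching on `S.erase k`. -/
theorem IsMatching.erase_of_subset {ι : Type*} [DecidableEq ι] {S : Finset ι}
    {M N : Finset (ι × ι)} {k : ι} (hM : IsMatching S M) (hN : N ⊆ M)
    (hk : ∀ p ∈ N, p.1 ≠ k ∧ p.2 ≠ k) : IsMatching (S.erase k) N := by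
  refine ⟨fun p hp => ?_, fun p hp q hq => hM.2.1 p (hN hp) q (hN hq),
    fun p hp q hq => hM.2.2 p (hN hp) q (hN hq)⟩
  have := Finset.mem_product.1 (hM.1 (hN hp))
  simp [this, hk p hp]

/-- Contracting the pairs `(i, k)` and `(k, j)` of a matching into `(i, j)` gives a matching
on `S.erase k`. -/
theorem IsMatching.contract {ι : Type*} [DecidableEq ι] {S : Finset ι}
    {M : Finset (ι × ι)} {k i j : ι} (hM : IsMatching S M) (hik : (i, k) ∈ M)
    (hkj : (k, j) ∈ M) (hi : i ≠ k) (hj : j ≠ k) :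
    IsMatching (S.erase k) (insert (i, j) ((M.erase (i, k)).erase (k, j))) := by
  obtain ⟨hS, h1, h2⟩ := hM
  have hiS := Finset.mem_product.1 (hS hik)
  have hjS := Finset.mem_product.1 (hS hkj)
  refine ⟨fun p hp => ?_, fun p hp q hq hpq => ?_, fun p hp q hq hpq => ?_⟩
  · have := @hS p
    grind
  · grind
  · grind

/-- Under (C1), deleting user `k` from a matching costs at most `α k k`. -/
theorem IsMatching.sum_le_wStar_erase_add {ι : Type*} [DecidableEq ι] {α : ι → ι → ℝ}
    (hα : ∀ i j, 0 ≤ α i j) (hC1 : CondC1 α) {S : Finset ι} {M : Finset (ι × ι)}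
    (hM : IsMatching S M) (k : ι) :
    ∑ p ∈ M, alphaP α p.1 p.2 ≤ wStar (alphaP α) (S.erase k) + α k k := by
  have hcol : ∀ i, i ≠ k → alphaP α i k ≤ α k k := fun i hi => by
    have := hC1 k i i hi hi
    simp only [alphaP, if_true, if_neg hi] at this ⊢
    linarith [hα k i]
  have hrow : ∀ j, j ≠ k → alphaP α k j ≤ α k k := fun j hj => by
    have := hC1 k j j hj hj
    simp only [alphaP, if_true, if_neg hj.symm] at this ⊢
    linarith [hα j k]
  have h1 := hM.2.1
  have h2 := hM.2.2
  by_cases hI : ∃ i, i ≠ k ∧ (i, k) ∈ M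
  · obtain ⟨i, hi, hik⟩ := hI
    have hsum := Finset.add_sum_erase M (fun p => alphaP α p.1 p.2) hik
    by_cases hJ : ∃ j, j ≠ k ∧ (k, j) ∈ M
    · obtain ⟨j, hj, hkj⟩ := hJ
      have hle := (hM.contract hik hkj hi hj).sum_le_wStar (alphaP α)
      rw [Finset.sum_insert (by grind)] at hle
      have hsum' := Finset.add_sum_erase (M.erase (i, k)) (fun p => alphaP α p.1 p.2)
        (a := (k, j)) (by grind)
      have hC := hC1 k i j hi hj
      have ei : alphaP α i k = α i k := if_neg hi
      have ej : alphaP α k j = α k j := if_neg hj.symm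
      simp only at hsum hsum' hle
      linarith
    · have hle := (hM.erase_of_subset (N := M.erase (i, k)) (k := k) (Finset.erase_subset _ _)
        (by grind)).sum_le_wStar (alphaP α)
      linarith [hcol i hi]
  · by_cases hJ : ∃ j, j ≠ k ∧ (k, j) ∈ M
    · obtain ⟨j, hj, hkj⟩ := hJ
      have hsum := Finset.add_sum_erase M (fun p => alphaP α p.1 p.2) hkj
      have hle := (hM.erase_of_subset (N := M.erase (k, j)) (k := k) (Finset.erase_subset _ _)
        (by grind)).sum_le_wStar (alphaP α)
      linarith [hrow j hj]
    · have hle := (hM.erase_of_subset (N := M.erase (k, k)) (k := k) (Finset.erase_subset _ _)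
        (by grind)).sum_le_wStar (alphaP α)
      rw [Finset.sum_erase M (by simp [alphaP])] at hle
      linarith [hα k k]

/-- Under condition (C1), for every `S` and every `k ∈ S`, the increase
of the maximum matching weight caused by including user `k` is at most the desired signal
strength of user `k`: `w(M*_S) − w(M*_{S∖{k}}) ≤ α_{kk}`. -/
theorem wStar_diff_le_diag_of_C1 {ι : Type*} [Fintype ι] [DecidableEq ι]
    (α : ι → ι → ℝ) (hα : ∀ i j, 0 ≤ α i j) (hC1 : CondC1 α) :
    ∀ S : Finset ι, ∀ k ∈ S,
      wStar (alphaP α) S - wStar (alphaP α) (S.erase k) ≤ α k k := by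
  intro S k _
  rw [sub_le_iff_le_add']
  exact wStar_le fun M hM => hM.sum_le_wStar_erase_add hα hC1 k
end
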